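/- arXiv:1708.01832 — 2 statements merged into one kernel-verified Lean document; each statement's English description precedes it below -/
import Mathlib

section
/- If (ζ, ψ) ∈ C_T and I_T(ζ, ψ) < ∞, then the infimum defining I_T(ζ, ψ) is attained: there exists φ ∈ S_T(ζ, ψ) such that ∑_{k≥0} ∫_{[0,T]×[0,1]} ℓ(φ_k(s,y)) ds dy = I_T(ζ, ψ). -/
open MeasureTheory Filter Topology
open scoped ENNReal

noncomputable def ell (x : ℝ) : ℝ := x * Real.log x - x + 1

noncomputable def rtot (x : ℕ → ℝ) : ℝ := max (x 0) 0 + ∑' k : ℕ, (k : ℝ) * x k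

noncomputable def rcoord (x : ℕ → ℝ) (k : ℕ) : ℝ :=
  if 0 < rtot x then (if k = 0 then max (x 0) 0 else (k : ℝ) * x k) / rtot x else 0

noncomputable def skorokhod (ψ : ℝ → ℝ) (t : ℝ) : ℝ :=
  ψ t - min (sInf (ψ '' Set.Icc 0 t)) 0

def AbsCont (f : ℝ → ℝ) (a b : ℝ) : Prop :=
  ∀ ε > 0, ∃ δ > 0, ∀ n : ℕ, ∀ I : Fin n → ℝ × ℝ,
    (∀ i, (I i).1 ∈ Set.Icc a b ∧ (I i).2 ∈ Set.Icc a b ∧ (I i).1 ≤ (I i).2) →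
    (∀ i j, i ≠ j → Disjoint (Set.Ioo (I i).1 (I i).2) (Set.Ioo (I j).1 (I j).2)) →
    (∑ i, ((I i).2 - (I i).1)) < δ →
    (∑ i, |f (I i).2 - f (I i).1|) < ε

def memCT (T : ℝ) (p : ℕ → ℝ) (ζ : ℕ → ℝ → ℝ) (ψ : ℝ → ℝ) : Prop :=
  (∀ k, ContinuousOn (ζ k) (Set.Icc 0 T)) ∧
  ContinuousOn ψ (Set.Icc 0 T) ∧
  ψ 0 = 0 ∧ AbsCont ψ 0 T ∧
  (∀ t ∈ Set.Icc (0:ℝ) T, ζ 0 t = skorokhod ψ t) ∧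
  (∀ k : ℕ, 1 ≤ k →
    ζ k 0 = p k ∧ (∀ t ∈ Set.Icc (0:ℝ) T, 0 ≤ ζ k t) ∧
    AntitoneOn (ζ k) (Set.Icc 0 T) ∧ AbsCont (ζ k) 0 T)

noncomputable def Bint (ζ : ℕ → ℝ → ℝ) (φ : ℕ → ℝ → ℝ → ℝ) (k : ℕ) (t : ℝ) : ℝ :=
  ∫ q in (Set.Icc (0:ℝ) t) ×ˢ (Set.Icc (0:ℝ) 1),
    (if 0 ≤ q.2 ∧ q.2 < rcoord (fun j => ζ j q.1) k then φ k q.1 q.2 else 0)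

def memST (T : ℝ) (p : ℕ → ℝ) (ζ : ℕ → ℝ → ℝ) (ψ : ℝ → ℝ) (φ : ℕ → ℝ → ℝ → ℝ) : Prop :=
  (∀ k, Measurable (fun q : ℝ × ℝ => φ k q.1 q.2)) ∧
  (∀ k s y, 0 ≤ φ k s y) ∧
  (∀ k, IntegrableOn
      (fun q : ℝ × ℝ => if 0 ≤ q.2 ∧ q.2 < rcoord (fun j => ζ j q.1) k then φ k q.1 q.2 else 0)
      ((Set.Icc (0:ℝ) T) ×ˢ (Set.Icc (0:ℝ) 1))) ∧
  (∀ t ∈ Set.Icc (0:ℝ) T, ψ t = ∑' k : ℕ, ((k : ℝ) - 2) * Bint ζ φ k t) ∧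
  (∀ t ∈ Set.Icc (0:ℝ) T, ∀ k : ℕ, 1 ≤ k → ζ k t = p k - Bint ζ φ k t)

noncomputable def costE (T : ℝ) (φ : ℕ → ℝ → ℝ → ℝ) : ℝ≥0∞ :=
  ∑' k : ℕ, ∫⁻ q in (Set.Icc (0:ℝ) T) ×ˢ (Set.Icc (0:ℝ) 1),
    ENNReal.ofReal (ell (φ k q.1 q.2))

open Classical in
noncomputable def rateI (T : ℝ) (p : ℕ → ℝ) (ζ : ℕ → ℝ → ℝ) (ψ : ℝ → ℝ) : ℝ≥0∞ :=
  if memCT T p ζ ψ then ⨅ (φ : ℕ → ℝ → ℝ → ℝ) (_ : memST T p ζ ψ φ), costE T φ else ⊤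

/-- The integral of `f s ·` over the part of `[0, 1]` lying in `[0, R s)`. -/
noncomputable def fiberMass (R : ℝ → ℝ) (f : ℝ → ℝ → ℝ) (s : ℝ) : ℝ :=
  ∫ y in Set.Icc (0:ℝ) 1, if 0 ≤ y ∧ y < R s then f s y else 0

/-- The control `f` replaced by its fibrewise average below the graph of `R`, and by `1` elsewhere. -/
noncomputable def fiberAverage (R : ℝ → ℝ) (f : ℝ → ℝ → ℝ) (s y : ℝ) : ℝ :=
  if 0 ≤ y ∧ y < R s then fiberMass R f s / fiberMass R (fun _ _ => 1) s else 1

theorem ell_nonneg {x : ℝ} (hx : 0 ≤ x) : 0 ≤ ell x := by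
  have := Real.self_sub_one_le_mul_log hx
  unfold ell; linarith

theorem ell_one : ell 1 = 0 := by simp [ell]

theorem continuous_ell : Continuous ell := by
  unfold ell
  exact (Real.continuous_mul_log.sub continuous_id).add continuous_const

theorem convexOn_ell : ConvexOn ℝ (Set.Ici 0) ell := by
  have h1 : ConvexOn ℝ (Set.Ici (0:ℝ)) (fun x : ℝ => -x + 1) :=
    (concaveOn_id (convex_Ici 0)).neg.add_const 1
  exact (Real.convexOn_mul_log.add h1).congr fun x _ => by simp [ell]; ring

/-- Jensen's inequality for `ell`, without integrability of `ell ∘ g`. -/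
theorem measure_mul_ell_average_le {α : Type*} [MeasurableSpace α] (ν : Measure α)
    [IsFiniteMeasure ν] [NeZero ν] (g : α → ℝ) (hg : Integrable g ν) (hg0 : ∀ y, 0 ≤ g y) :
    ν Set.univ * ENNReal.ofReal (ell (⨍ y, g y ∂ν)) ≤ ∫⁻ y, ENNReal.ofReal (ell (g y)) ∂ν := by
  by_cases htop : ∫⁻ y, ENNReal.ofReal (ell (g y)) ∂ν = ⊤
  · simp [htop]
  have hell : Integrable (fun y => ell (g y)) ν := by
    refine ⟨continuous_ell.comp_aestronglyMeasurable hg.1, ?_⟩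
    rw [hasFiniteIntegral_iff_ofReal (ae_of_all _ fun y => ell_nonneg (hg0 y))]
    exact Ne.lt_top htop
  have hj := convexOn_ell.map_average_le continuous_ell.continuousOn isClosed_Ici
    (ae_of_all ν fun y => hg0 y) hg hell
  rw [← ofReal_integral_eq_lintegral_ofReal hell (ae_of_all _ fun y => ell_nonneg (hg0 y)),
    ← measure_smul_average ν (fun y => ell (g y)), smul_eq_mul,
    ENNReal.ofReal_mul measureReal_nonneg, ofReal_measureReal]
  gcongr

theorem measurableSet_lt_fiber (r : ℝ) : MeasurableSet {y : ℝ | 0 ≤ y ∧ y < r} :=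
  measurableSet_Ico

theorem ite_eq_indicator (r : ℝ) (h : ℝ → ℝ) :
    (fun y => if 0 ≤ y ∧ y < r then h y else 0) = {y : ℝ | 0 ≤ y ∧ y < r}.indicator h := by
  ext y
  by_cases hy : 0 ≤ y ∧ y < r <;> simp [hy]

theorem measurable_below_graph {R : ℝ → ℝ} (hR : Measurable R) {f : ℝ → ℝ → ℝ}
    (hf : Measurable fun q : ℝ × ℝ => f q.1 q.2) {g : ℝ → ℝ → ℝ}
    (hg : Measurable fun q : ℝ × ℝ => g q.1 q.2) :
    Measurable fun q : ℝ × ℝ => if 0 ≤ q.2 ∧ q.2 < R q.1 then f q.1 q.2 else g q.1 q.2 :=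
  Measurable.ite ((measurableSet_le measurable_const measurable_snd).inter
    (measurableSet_lt measurable_snd (hR.comp measurable_fst))) hf hg

theorem measurable_fiberMass {R : ℝ → ℝ} (hR : Measurable R) {f : ℝ → ℝ → ℝ}
    (hf : Measurable fun q : ℝ × ℝ => f q.1 q.2) : Measurable (fiberMass R f) := by
  have := (measurable_below_graph hR hf (g := fun _ _ => 0) measurable_const).stronglyMeasurable
  exact (this.integral_prod_right (ν := volume.restrict (Set.Icc (0:ℝ) 1))).measurable

theorem measurable_fiberAverage {R : ℝ → ℝ} (hR : Measurable R) {f : ℝ → ℝ → ℝ}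
    (hf : Measurable fun q : ℝ × ℝ => f q.1 q.2) :
    Measurable fun q : ℝ × ℝ => fiberAverage R f q.1 q.2 :=
  measurable_below_graph hR
    (f := fun s _ => fiberMass R f s / fiberMass R (fun _ _ => 1) s) (g := fun _ _ => 1)
    (((measurable_fiberMass hR hf).div
      (measurable_fiberMass hR measurable_const)).comp measurable_fst) measurable_const

theorem fiberMass_nonneg (R : ℝ → ℝ) {f : ℝ → ℝ → ℝ} (hf : ∀ s y, 0 ≤ f s y) (s : ℝ) :
    0 ≤ fiberMass R f s :=
  integral_nonneg fun y => by dsimp only; split_ifs <;> simp [hf]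

theorem fiberAverage_nonneg (R : ℝ → ℝ) {f : ℝ → ℝ → ℝ} (hf : ∀ s y, 0 ≤ f s y) (s y : ℝ) :
    0 ≤ fiberAverage R f s y := by
  unfold fiberAverage
  split_ifs
  · exact div_nonneg (fiberMass_nonneg R hf s) (fiberMass_nonneg R (fun _ _ => zero_le_one) s)
  · exact zero_le_one

theorem fiberMass_eq_setIntegral (R : ℝ → ℝ) (f : ℝ → ℝ → ℝ) (s : ℝ) :
    fiberMass R f s = ∫ y, f s y ∂((volume.restrict (Set.Icc (0:ℝ) 1)).restrict
      {y : ℝ | 0 ≤ y ∧ y < R s}) := by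
  rw [← integral_indicator (measurableSet_lt_fiber _), fiberMass, ite_eq_indicator]

theorem fiberMass_one (R : ℝ → ℝ) (s : ℝ) :
    fiberMass R (fun _ _ => 1) s =
      (volume.restrict (Set.Icc (0:ℝ) 1)).real {y : ℝ | 0 ≤ y ∧ y < R s} := by
  simp [fiberMass_eq_setIntegral]

theorem fiberMass_fiberAverage (R : ℝ → ℝ) (f : ℝ → ℝ → ℝ) (s : ℝ) :
    fiberMass R (fiberAverage R f) s = fiberMass R f s := by
  have h1 : fiberMass R (fiberAverage R f) s =
      fiberMass R f s / fiberMass R (fun _ _ => 1) s * fiberMass R (fun _ _ => 1) s := by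
    conv_lhs => unfold fiberMass
    conv_rhs => arg 2; unfold fiberMass
    rw [← integral_const_mul]
    congr 1
    ext y
    by_cases h : 0 ≤ y ∧ y < R s <;> simp [h, fiberAverage]
  rw [h1]
  by_cases h0 : fiberMass R (fun _ _ => 1) s = 0
  · rw [h0, mul_zero, fiberMass_eq_setIntegral]
    rw [fiberMass_one, measureReal_eq_zero_iff] at h0
    rw [Measure.restrict_eq_zero.2 h0, integral_zero_measure]
  · rw [div_mul_cancel₀ _ h0]

/-- On each fibre the averaged control has the least cost among controls of the same mass. -/
theorem lintegral_ell_fiberAverage_le (R : ℝ → ℝ) (f g : ℝ → ℝ → ℝ) (s : ℝ)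
    (hg0 : ∀ y, 0 ≤ g s y)
    (hg : Integrable (fun y => if 0 ≤ y ∧ y < R s then g s y else 0)
      (volume.restrict (Set.Icc (0:ℝ) 1)))
    (hfg : fiberMass R f s = fiberMass R g s) :
    ∫⁻ y in Set.Icc (0:ℝ) 1, ENNReal.ofReal (ell (fiberAverage R f s y)) ≤
      ∫⁻ y in Set.Icc (0:ℝ) 1, ENNReal.ofReal (ell (g s y)) := by
  set E : Set ℝ := {y : ℝ | 0 ≤ y ∧ y < R s} with hE
  have hEm : MeasurableSet E := measurableSet_lt_fiber _
  set ν := (volume.restrict (Set.Icc (0:ℝ) 1)).restrict E with hν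
  have h1 : ∫⁻ y in Set.Icc (0:ℝ) 1, ENNReal.ofReal (ell (fiberAverage R f s y)) =
      ∫⁻ _, ENNReal.ofReal (ell (fiberMass R f s / fiberMass R (fun _ _ => 1) s)) ∂ν := by
    rw [hν, ← lintegral_indicator hEm]
    congr 1
    ext y
    by_cases h : 0 ≤ y ∧ y < R s <;> simp [h, hE, fiberAverage, ell_one]
  rw [h1]
  refine le_trans ?_ (lintegral_mono' (Measure.restrict_le_self (s := E)) le_rfl)
  rw [← hν, lintegral_const]
  by_cases h0 : ν = 0
  · simp [h0]
  have : NeZero ν := ⟨h0⟩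
  have hint : Integrable (fun y => g s y) ν := by
    rw [ite_eq_indicator] at hg
    exact (integrable_indicator_iff hEm).1 hg
  have hj := measure_mul_ell_average_le ν (fun y => g s y) hint hg0
  have havg : ⨍ y, g s y ∂ν = fiberMass R f s / fiberMass R (fun _ _ => 1) s := by
    rw [hfg, fiberMass_eq_setIntegral, fiberMass_eq_setIntegral, average_eq, ← hE, ← hν]
    simp [div_eq_inv_mul]
  rwa [havg, mul_comm] at hj

section Strip

variable {T : ℝ} {R : ℝ → ℝ} {f g : ℝ → ℝ → ℝ}

/-- `f` cut off to the region below the graph of `R`. -/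
noncomputable def cutoff (R : ℝ → ℝ) (f : ℝ → ℝ → ℝ) (q : ℝ × ℝ) : ℝ :=
  if 0 ≤ q.2 ∧ q.2 < R q.1 then f q.1 q.2 else 0

theorem volume_restrict_prod (S S' : Set ℝ) :
    (volume : Measure (ℝ × ℝ)).restrict (S ×ˢ S') =
      (volume.restrict S).prod (volume.restrict S') := by
  rw [Measure.prod_restrict]; rfl

theorem integrableOn_fiberMass (S : Set ℝ)
    (hf : IntegrableOn (cutoff R f) (S ×ˢ Set.Icc (0:ℝ) 1)) :
    IntegrableOn (fiberMass R f) S := by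
  rw [IntegrableOn, volume_restrict_prod] at hf
  exact hf.integral_prod_left

theorem setIntegral_cutoff (S : Set ℝ)
    (hf : IntegrableOn (cutoff R f) (S ×ˢ Set.Icc (0:ℝ) 1)) :
    ∫ q in S ×ˢ Set.Icc (0:ℝ) 1, cutoff R f q = ∫ s in S, fiberMass R f s := by
  rw [IntegrableOn, volume_restrict_prod] at hf
  rw [volume_restrict_prod, integral_prod _ hf]
  rfl

theorem integrableOn_cutoff_fiberAverage (hR : Measurable R)
    (hfm : Measurable fun q : ℝ × ℝ => f q.1 q.2) (hf0 : ∀ s y, 0 ≤ f s y) (S : Set ℝ)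
    (hf : IntegrableOn (cutoff R f) (S ×ˢ Set.Icc (0:ℝ) 1)) :
    IntegrableOn (cutoff R (fiberAverage R f)) (S ×ˢ Set.Icc (0:ℝ) 1) := by
  have hm : Measurable (cutoff R (fiberAverage R f)) :=
    measurable_below_graph hR (measurable_fiberAverage hR hfm) (g := fun _ _ => 0)
      measurable_const
  rw [IntegrableOn, volume_restrict_prod, integrable_prod_iff hm.aestronglyMeasurable]
  constructor
  · refine ae_of_all _ fun s => ?_
    have : (fun y => cutoff R (fiberAverage R f) (s, y)) =
        Set.indicator {y : ℝ | 0 ≤ y ∧ y < R s}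
          (fun _ => fiberMass R f s / fiberMass R (fun _ _ => 1) s) := by
      ext y
      by_cases h : 0 ≤ y ∧ y < R s <;> simp [h, cutoff, fiberAverage]
    rw [this]
    exact (integrable_const _).indicator (measurableSet_lt_fiber _)
  · refine (integrableOn_fiberMass S hf).congr (ae_of_all _ fun s => ?_)
    dsimp only
    rw [← fiberMass_fiberAverage]
    unfold fiberMass
    congr 1
    ext y
    by_cases h : 0 ≤ y ∧ y < R s
    · simp [h, cutoff, abs_of_nonneg (fiberAverage_nonneg R hf0 s y)]
    · simp [h, cutoff]

/-- An integrable nonnegative function on `[0, T]` is determined by its running integral. -/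
theorem ae_eq_of_forall_setIntegral_Icc_eq {u v : ℝ → ℝ}
    (hu : IntegrableOn u (Set.Icc 0 T)) (hv : IntegrableOn v (Set.Icc 0 T))
    (hu0 : ∀ s, 0 ≤ u s) (hv0 : ∀ s, 0 ≤ v s)
    (h : ∀ t ∈ Set.Icc (0:ℝ) T, ∫ s in Set.Icc 0 t, u s = ∫ s in Set.Icc 0 t, v s) :
    u =ᵐ[volume.restrict (Set.Icc 0 T)] v := by
  set ν := (volume : Measure ℝ).restrict (Set.Icc 0 T) with hν
  have fin : ∀ w : ℝ → ℝ, Integrable w ν → (∀ s, 0 ≤ w s) →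
      ∫⁻ s, ENNReal.ofReal (w s) ∂ν ≠ ⊤ := fun w hw hw0 =>
    ((hasFiniteIntegral_iff_ofReal (ae_of_all _ hw0)).1 hw.2).ne
  have key : ν.withDensity (fun s => ENNReal.ofReal (u s)) =
      ν.withDensity (fun s => ENNReal.ofReal (v s)) := by
    have : IsFiniteMeasure (ν.withDensity fun s => ENNReal.ofReal (u s)) :=
      isFiniteMeasure_withDensity (fin u hu hu0)
    refine Measure.ext_of_Iic _ _ fun t => ?_
    rw [withDensity_apply _ measurableSet_Iic, withDensity_apply _ measurableSet_Iic, hν,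
      Measure.restrict_restrict measurableSet_Iic]
    have hset : Set.Iic t ∩ Set.Icc 0 T = Set.Icc 0 (min t T) := by
      ext; simp; tauto
    rw [hset]
    have hsub : Set.Icc 0 (min t T) ⊆ Set.Icc 0 T := Set.Icc_subset_Icc_right (min_le_right _ _)
    rw [← ofReal_integral_eq_lintegral_ofReal (hu.mono_set hsub) (ae_of_all _ hu0),
      ← ofReal_integral_eq_lintegral_ofReal (hv.mono_set hsub) (ae_of_all _ hv0)]
    by_cases ht : 0 ≤ min t T
    · rw [h _ ⟨ht, min_le_right _ _⟩]
    · rw [Set.Icc_eq_empty ht]; simp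
  have := (withDensity_eq_iff hu.1.aemeasurable.ennreal_ofReal hv.1.aemeasurable.ennreal_ofReal
    (fin u hu hu0)).1 key
  filter_upwards [this] with s hs
  rwa [ENNReal.ofReal_eq_ofReal_iff (hu0 s) (hv0 s)] at hs

theorem lintegral_strip_ell_fiberAverage_le (hR : Measurable R)
    (hfm : Measurable fun q : ℝ × ℝ => f q.1 q.2)
    (hgm : Measurable fun q : ℝ × ℝ => g q.1 q.2) (hf0 : ∀ s y, 0 ≤ f s y)
    (hg0 : ∀ s y, 0 ≤ g s y)
    (hf : IntegrableOn (cutoff R f) (Set.Icc 0 T ×ˢ Set.Icc (0:ℝ) 1))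
    (hg : IntegrableOn (cutoff R g) (Set.Icc 0 T ×ˢ Set.Icc (0:ℝ) 1))
    (h : ∀ t ∈ Set.Icc (0:ℝ) T, ∫ q in Set.Icc 0 t ×ˢ Set.Icc (0:ℝ) 1, cutoff R f q =
      ∫ q in Set.Icc 0 t ×ˢ Set.Icc (0:ℝ) 1, cutoff R g q) :
    ∫⁻ q in Set.Icc 0 T ×ˢ Set.Icc (0:ℝ) 1, ENNReal.ofReal (ell (fiberAverage R f q.1 q.2)) ≤
      ∫⁻ q in Set.Icc 0 T ×ˢ Set.Icc (0:ℝ) 1, ENNReal.ofReal (ell (g q.1 q.2)) := by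
  have hmass : fiberMass R f =ᵐ[volume.restrict (Set.Icc 0 T)] fiberMass R g := by
    refine ae_eq_of_forall_setIntegral_Icc_eq (integrableOn_fiberMass _ hf)
      (integrableOn_fiberMass _ hg) (fiberMass_nonneg R hf0) (fiberMass_nonneg R hg0)
      fun t ht => ?_
    have hsub : Set.Icc 0 t ×ˢ Set.Icc (0:ℝ) 1 ⊆ Set.Icc 0 T ×ˢ Set.Icc (0:ℝ) 1 :=
      Set.prod_mono (Set.Icc_subset_Icc_right ht.2) le_rfl
    rw [← setIntegral_cutoff _ (hf.mono_set hsub), ← setIntegral_cutoff _ (hg.mono_set hsub),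
      h t ht]
  have hfib := hg
  rw [IntegrableOn, volume_restrict_prod] at hfib
  rw [volume_restrict_prod, lintegral_prod, lintegral_prod]
  · refine lintegral_mono_ae ?_
    filter_upwards [hmass, hfib.prod_right_ae] with s hs hgs
    exact lintegral_ell_fiberAverage_le R f g s (hg0 s) hgs hs
  · exact (continuous_ell.measurable.comp hgm).ennreal_ofReal.aemeasurable
  · exact (continuous_ell.measurable.comp
      (measurable_fiberAverage hR hfm)).ennreal_ofReal.aemeasurable

end Strip

section Trajectory

variable {T : ℝ} {p : ℕ → ℝ} {ζ : ℕ → ℝ → ℝ} {ψ : ℝ → ℝ} {φ φ' : ℕ → ℝ → ℝ → ℝ}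

theorem memCT.le_init (h : memCT T p ζ ψ) {k : ℕ} (hk : 1 ≤ k) {t : ℝ}
    (ht : t ∈ Set.Icc (0:ℝ) T) : ζ k t ≤ p k := by
  obtain ⟨h0, -, hanti, -⟩ := h.2.2.2.2.2 k hk
  rw [← h0]
  exact hanti ⟨le_rfl, ht.1.trans ht.2⟩ ht ht.1

/-- The weights `r_k (ζ s)`, extended in `s` by constants outside `[0, T]`. -/
noncomputable def weight (hT : 0 ≤ T) (ζ : ℕ → ℝ → ℝ) (k : ℕ) (s : ℝ) : ℝ :=
  rcoord (fun j => ζ j (Set.projIcc 0 T hT s)) k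

theorem weight_eq (hT : 0 ≤ T) {s : ℝ} (hs : s ∈ Set.Icc (0:ℝ) T) (k : ℕ) :
    weight hT ζ k s = rcoord (fun j => ζ j s) k := by
  rw [weight, Set.projIcc_of_mem hT hs]

theorem measurable_weight (hT : 0 ≤ T) (hp : Summable fun k : ℕ => (k : ℝ) * p k)
    (h : memCT T p ζ ψ) (k : ℕ) : Measurable (weight hT ζ k) := by
  have hc : ∀ j, Continuous fun s => ζ j (Set.projIcc 0 T hT s) := fun j =>
    (h.1 j).comp_continuous (continuous_subtype_val.comp continuous_projIcc)
      fun s => (Set.projIcc 0 T hT s).2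
  have hr : Continuous fun s => rtot (fun j => ζ j (Set.projIcc 0 T hT s)) := by
    unfold rtot
    refine ((hc 0).max continuous_const).add
      (continuous_tsum (fun j => continuous_const.mul (hc j)) hp fun j s => ?_)
    rcases Nat.eq_zero_or_pos j with rfl | hj
    · simp
    · have hs := (Set.projIcc 0 T hT s).2
      rw [Real.norm_of_nonneg (mul_nonneg j.cast_nonneg ((h.2.2.2.2.2 j hj).2.1 _ hs))]
      exact mul_le_mul_of_nonneg_left (h.le_init hj hs) j.cast_nonneg
  unfold weight rcoord
  refine Measurable.ite (measurableSet_lt measurable_const hr.measurable) ?_ measurable_const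
  refine Measurable.div ?_ hr.measurable
  by_cases hk : k = 0
  · simpa [hk] using ((hc 0).max continuous_const).measurable
  · simpa [hk] using (hc k).measurable.const_mul (k : ℝ)

theorem Bint_eq (hT : 0 ≤ T) {t : ℝ} (ht : t ∈ Set.Icc (0:ℝ) T) (k : ℕ) :
    Bint ζ φ k t = ∫ q in Set.Icc 0 t ×ˢ Set.Icc (0:ℝ) 1, cutoff (weight hT ζ k) (φ k) q := by
  refine setIntegral_congr_fun (measurableSet_Icc.prod measurableSet_Icc) fun q hq => ?_
  have hs : q.1 ∈ Set.Icc (0:ℝ) T := ⟨hq.1.1, hq.1.2.trans ht.2⟩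
  simp only [cutoff, weight_eq hT hs]

theorem integrableOn_below_rcoord_iff (hT : 0 ≤ T) (k : ℕ) :
    IntegrableOn
      (fun q : ℝ × ℝ => if 0 ≤ q.2 ∧ q.2 < rcoord (fun j => ζ j q.1) k then φ k q.1 q.2 else 0)
      ((Set.Icc (0:ℝ) T) ×ˢ (Set.Icc (0:ℝ) 1)) ↔
    IntegrableOn (cutoff (weight hT ζ k) (φ k)) (Set.Icc 0 T ×ˢ Set.Icc (0:ℝ) 1) := by
  refine integrableOn_congr_fun (fun q hq => ?_) (measurableSet_Icc.prod measurableSet_Icc)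
  simp only [cutoff, weight_eq hT hq.1]

/-- The trajectory `(ζ, ψ)` determines the jump intensities of any admissible control. -/
theorem memST.Bint_eq_Bint (hp : Summable p) (hp' : Summable fun k : ℕ => (k : ℝ) * p k)
    (h : memCT T p ζ ψ) (hφ : memST T p ζ ψ φ) (hφ' : memST T p ζ ψ φ') (k : ℕ) {t : ℝ}
    (ht : t ∈ Set.Icc (0:ℝ) T) : Bint ζ φ k t = Bint ζ φ' k t := by
  obtain ⟨-, -, -, hψ, hζ⟩ := hφ
  obtain ⟨-, -, -, hψ', hζ'⟩ := hφ'
  have hpos : ∀ j, Bint ζ φ (j + 1) t = Bint ζ φ' (j + 1) t := fun j => by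
    linarith [hζ t ht (j + 1) (by lia), hζ' t ht (j + 1) (by lia)]
  rcases k with _ | k
  swap
  · exact hpos k
  have hsum : ∀ χ : ℕ → ℝ → ℝ → ℝ, (∀ j, 1 ≤ j → ζ j t = p j - Bint ζ χ j t) →
      Summable fun j : ℕ => ((j : ℝ) - 2) * Bint ζ χ j t := by
    intro χ hχ
    rw [← summable_nat_add_iff 1]
    refine Summable.of_norm_bounded
      ((summable_nat_add_iff 1).2 (hp'.add (hp.mul_left 2))) fun j => ?_
    have h1 := hχ (j + 1) (by lia)
    have h2 := h.le_init (k := j + 1) (by lia) ht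
    have h3 := (h.2.2.2.2.2 (j + 1) (by lia)).2.1 t ht
    have hj : (0 : ℝ) ≤ ((j + 1 : ℕ) : ℝ) := Nat.cast_nonneg _
    rw [Real.norm_eq_abs, abs_mul, abs_of_nonneg (by linarith : 0 ≤ Bint ζ χ (j + 1) t),
      ← add_mul]
    refine mul_le_mul ?_ (by linarith) (by linarith) (by linarith)
    rw [abs_le]
    constructor <;> linarith
  have e := (hψ t ht).symm.trans (hψ' t ht)
  rw [(hsum φ (hζ t ht)).tsum_eq_zero_add, (hsum φ' (hζ' t ht)).tsum_eq_zero_add] at e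
  simp only [hpos, Nat.cast_zero] at e
  linarith

end Trajectory

/-- The infimum defining the rate function `I_T(ζ, ψ)` is attained whenever it is
finite. -/
theorem rate_infimum_attained (T : ℝ) (hT : 0 < T)
    (p : ℕ → ℝ) (hp0 : p 0 = 0) (hpnn : ∀ k, 0 ≤ p k) (hp1 : ∑' k : ℕ, p k = 1)
    (hmom : ∃ ε : ℝ, 0 < ε ∧ Summable fun k : ℕ => p k * (k : ℝ) ^ ((1 : ℝ) + ε))
    (ζ : ℕ → ℝ → ℝ) (ψ : ℝ → ℝ)
    (hCT : memCT T p ζ ψ) (hfin : rateI T p ζ ψ < ⊤) :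
    ∃ φ : ℕ → ℝ → ℝ → ℝ, memST T p ζ ψ φ ∧ costE T φ = rateI T p ζ ψ := by
  have hp : Summable p := by
    by_contra hns
    rw [tsum_eq_zero_of_not_summable hns] at hp1
    exact zero_ne_one hp1
  have hp' : Summable fun k : ℕ => (k : ℝ) * p k := by
    obtain ⟨ε, hε, hs⟩ := hmom
    refine Summable.of_nonneg_of_le (fun k => mul_nonneg k.cast_nonneg (hpnn k)) (fun k => ?_) hs
    rw [mul_comm]
    refine mul_le_mul_of_nonneg_left ?_ (hpnn k)
    rcases Nat.eq_zero_or_pos k with rfl | hk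
    · simp [Real.zero_rpow (by linarith : (1:ℝ) + ε ≠ 0)]
    · exact Real.self_le_rpow_of_one_le (by exact_mod_cast hk) (by linarith)
  have hrate : rateI T p ζ ψ = ⨅ (φ : ℕ → ℝ → ℝ → ℝ) (_ : memST T p ζ ψ φ), costE T φ :=
    if_pos hCT
  rw [hrate] at hfin ⊢
  obtain ⟨φ, hfin⟩ := iInf_lt_iff.1 hfin
  obtain ⟨hφ, -⟩ := iInf_lt_iff.1 hfin
  have hR := measurable_weight hT.le hp' hCT
  have hint := fun k => (integrableOn_below_rcoord_iff hT.le k).1 (hφ.2.2.1 k)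
  set φs : ℕ → ℝ → ℝ → ℝ := fun k => fiberAverage (weight hT.le ζ k) (φ k)
  have hints := fun k =>
    integrableOn_cutoff_fiberAverage (hR k) (hφ.1 k) (hφ.2.1 k) _ (hint k)
  have hB : ∀ k, ∀ t ∈ Set.Icc (0:ℝ) T, Bint ζ φs k t = Bint ζ φ k t := fun k t ht => by
    have hsub : Set.Icc 0 t ×ˢ Set.Icc (0:ℝ) 1 ⊆ Set.Icc 0 T ×ˢ Set.Icc (0:ℝ) 1 :=
      Set.prod_mono (Set.Icc_subset_Icc_right ht.2) le_rfl
    rw [Bint_eq hT.le ht, Bint_eq hT.le ht, setIntegral_cutoff _ ((hint k).mono_set hsub),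
      setIntegral_cutoff _ ((hints k).mono_set hsub)]
    simp only [fiberMass_fiberAverage]
  have hφs_mem : memST T p ζ ψ φs := by
    refine ⟨fun k => measurable_fiberAverage (hR k) (hφ.1 k),
      fun k => fiberAverage_nonneg _ (hφ.2.1 k),
      fun k => (integrableOn_below_rcoord_iff hT.le k).2 (hints k), fun t ht => ?_,
      fun t ht k hk => ?_⟩
    · simp only [fun k => hB k t ht]
      exact hφ.2.2.2.1 t ht
    · rw [hB k t ht]
      exact hφ.2.2.2.2 t ht k hk
  refine ⟨φs, hφs_mem, le_antisymm (le_iInf₂ fun χ hχ => ?_) (iInf₂_le φs hφs_mem)⟩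
  refine ENNReal.tsum_le_tsum fun k => ?_
  refine lintegral_strip_ell_fiberAverage_le (hR k) (hφ.1 k) (hχ.1 k) (hφ.2.1 k) (hχ.2.1 k)
    (hint k) ((integrableOn_below_rcoord_iff hT.le k).1 (hχ.2.2.1 k)) fun t ht => ?_
  rw [← Bint_eq hT.le ht, ← Bint_eq hT.le ht]
  exact hφ.Bint_eq_Bint hp hp' hCT hχ k ht
end

section
/- Let (ζ, ψ) ∈ C_T be a pair for which S_T(ζ, ψ) is nonempty. If r(ζ(t*)) = 0 for some t* ∈ [0,T], then ζ(t) = 0 (i.e. ζ_k(t) = 0 for all k ≥ 0) for every t ∈ [t*, T]. Consequently, with τ_ζ := min(inf{t ∈ [0,T] : r(ζ(t)) = 0}, T), one has ζ(t) = 0 for all t ∈ [τ_ζ, T] whenever r(ζ(τ_ζ)) = 0. -/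
open MeasureTheory Filter Topology
open scoped ENNReal

/-- At each time of `[0, T]`, the Skorokhod map of a continuous path is nonnegative. -/
theorem skorokhod_nonneg {ψ : ℝ → ℝ} {T t : ℝ} (hψ : ContinuousOn ψ (Set.Icc 0 T))
    (ht : t ∈ Set.Icc 0 T) : 0 ≤ skorokhod ψ t := by
  have hbdd : BddBelow (ψ '' Set.Icc 0 t) :=
    (isCompact_Icc.image_of_continuousOn (hψ.mono (Set.Icc_subset_Icc_right ht.2))).bddBelow
  have h := csInf_le hbdd (Set.mem_image_of_mem ψ (Set.right_mem_Icc.2 ht.1))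
  exact sub_nonneg.2 ((min_le_left _ _).trans h)

/-- If the Skorokhod map vanishes at `s` and the path is nonincreasing from then on, the Skorokhod
map stays at zero. -/
theorem skorokhod_eq_zero_of_antitoneOn {ψ : ℝ → ℝ} {T s t : ℝ}
    (hψ : ContinuousOn ψ (Set.Icc 0 T)) (hs : 0 ≤ s) (hst : s ≤ t) (htT : t ≤ T)
    (hanti : AntitoneOn ψ (Set.Icc s T)) (h0 : skorokhod ψ s = 0) : skorokhod ψ t = 0 := by
  refine le_antisymm ?_ (skorokhod_nonneg hψ ⟨hs.trans hst, htT⟩)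
  have hbdd : BddBelow (ψ '' Set.Icc 0 s) :=
    (isCompact_Icc.image_of_continuousOn
      (hψ.mono (Set.Icc_subset_Icc_right (hst.trans htT)))).bddBelow
  have hmin : ψ s = min (sInf (ψ '' Set.Icc 0 s)) 0 := sub_eq_zero.1 h0
  have hle : ψ t ≤ ψ s := hanti ⟨le_rfl, hst.trans htT⟩ ⟨hst, htT⟩ hst
  refine sub_nonpos.2 (le_min (le_csInf ⟨_, Set.mem_image_of_mem ψ (Set.left_mem_Icc.2
    (hs.trans hst))⟩ ?_) (hle.trans (hmin.le.trans (min_le_right _ _))))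
  rintro _ ⟨u, hu, rfl⟩
  rcases le_total u s with hus | hsu
  · exact hle.trans ((hmin.le.trans (min_le_left _ _)).trans
      (csInf_le hbdd (Set.mem_image_of_mem ψ ⟨hu.1, hus⟩)))
  · exact hanti ⟨hsu, hu.2.trans htT⟩ ⟨hst, htT⟩ hu.2

theorem Bint_mono {T : ℝ} {p : ℕ → ℝ} {ζ : ℕ → ℝ → ℝ} {ψ : ℝ → ℝ} {φ : ℕ → ℝ → ℝ → ℝ}
    (hST : memST T p ζ ψ φ) (k : ℕ) {s t : ℝ} (hst : s ≤ t) (htT : t ≤ T) :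
    Bint ζ φ k s ≤ Bint ζ φ k t := by
  obtain ⟨-, hnn, hint, -, -⟩ := hST
  refine setIntegral_mono_set
    ((hint k).mono_set (Set.prod_mono (Set.Icc_subset_Icc_right htT) subset_rfl))
    (Eventually.of_forall fun q => ?_)
    (Set.prod_mono (Set.Icc_subset_Icc_right hst) subset_rfl).eventuallyLE
  simp only [Pi.zero_apply]
  split_ifs
  exacts [hnn _ _ _, le_rfl]

/-- A nonnegative summable state of total rate zero has all coordinates zero. -/
theorem eq_zero_of_rtot_eq_zero {x : ℕ → ℝ} (hx : ∀ k, 0 ≤ x k)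
    (hsum : Summable fun k : ℕ => (k : ℝ) * x k) (h : rtot x = 0) (k : ℕ) : x k = 0 := by
  have hnn : ∀ k : ℕ, 0 ≤ (k : ℝ) * x k := fun k => mul_nonneg k.cast_nonneg (hx k)
  have htsum : 0 ≤ ∑' k : ℕ, (k : ℝ) * x k := tsum_nonneg hnn
  have hmax := le_max_right (x 0) 0
  unfold rtot at h
  rcases Nat.eq_zero_or_pos k with rfl | hk
  · exact le_antisymm (by linarith [le_max_left (x 0) 0]) (hx 0)
  · have hle := hsum.le_tsum k fun j _ => hnn j
    have hk' : (0 : ℝ) < k := Nat.cast_pos.2 hk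
    have hz : (k : ℝ) * x k = 0 := le_antisymm (by linarith) (hnn k)
    exact (mul_eq_zero.1 hz).resolve_left hk'.ne'

/-- Once the total rate vanishes, the whole state stays at zero. -/
theorem eq_zero_of_rtot_eq_zero_of_le {T : ℝ} {p : ℕ → ℝ} (hpsum : Summable p)
    (hμsum : Summable fun k : ℕ => (k : ℝ) * p k) {ζ : ℕ → ℝ → ℝ} {ψ : ℝ → ℝ}
    (hCT : memCT T p ζ ψ) {φ : ℕ → ℝ → ℝ → ℝ} (hST : memST T p ζ ψ φ) {s t : ℝ}
    (hs : s ∈ Set.Icc 0 T) (h0 : rtot (fun j => ζ j s) = 0) (hst : s ≤ t) (htT : t ≤ T)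
    (k : ℕ) : ζ k t = 0 := by
  obtain ⟨-, hψ, -, -, hΓ, hζ⟩ := hCT
  have hζnn : ∀ k, 0 ≤ ζ k s := fun k => by
    rcases Nat.eq_zero_or_pos k with rfl | hk
    · exact (hΓ s hs).symm ▸ skorokhod_nonneg hψ hs
    · exact (hζ k hk).2.1 s hs
  have hsum : Summable fun k : ℕ => (k : ℝ) * ζ k s := by
    refine hμsum.of_nonneg_of_le (fun k => mul_nonneg k.cast_nonneg (hζnn k)) fun k => ?_
    rcases Nat.eq_zero_or_pos k with rfl | hk
    · simp
    · obtain ⟨hk0, -, hmono, -⟩ := hζ k hk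
      exact mul_le_mul_of_nonneg_left
        (hk0 ▸ hmono ⟨le_rfl, hs.1.trans hs.2⟩ hs hs.1) k.cast_nonneg
  have hzero : ∀ k, ζ k s = 0 := eq_zero_of_rtot_eq_zero hζnn hsum h0
  have hpos : ∀ k, 1 ≤ k → ∀ u ∈ Set.Icc s T, ζ k u = 0 := fun k hk u hu => by
    have hu' : u ∈ Set.Icc 0 T := ⟨hs.1.trans hu.1, hu.2⟩
    exact le_antisymm (hzero k ▸ (hζ k hk).2.2.1 hs hu' hu.1) ((hζ k hk).2.1 u hu')
  rcases Nat.eq_zero_or_pos k with rfl | hk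
  swap
  · exact hpos k hk t ⟨hst, htT⟩
  have hB : ∀ k, 1 ≤ k → ∀ u ∈ Set.Icc s T, Bint ζ φ k u = p k := fun k hk u hu => by
    have h := hST.2.2.2.2 u ⟨hs.1.trans hu.1, hu.2⟩ k hk
    linarith [hpos k hk u hu]
  have hBsum : ∀ u ∈ Set.Icc s T, Summable fun k : ℕ => ((k : ℝ) - 2) * Bint ζ φ k u := by
    intro u hu
    have h : Summable fun k : ℕ => ((k : ℝ) - 2) * p k :=
      (hμsum.sub (hpsum.mul_left 2)).congr fun k => by ring
    refine (summable_nat_add_iff 1).1 (((summable_nat_add_iff 1).2 h).congr fun k => ?_)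
    rw [hB (k + 1) (Nat.le_add_left 1 k) u hu]
  have hanti : AntitoneOn ψ (Set.Icc s T) := by
    intro u hu v hv huv
    rw [hST.2.2.2.1 u ⟨hs.1.trans hu.1, hu.2⟩, hST.2.2.2.1 v ⟨hs.1.trans hv.1, hv.2⟩]
    refine (hBsum v hv).tsum_le_tsum (fun k => ?_) (hBsum u hu)
    rcases Nat.eq_zero_or_pos k with rfl | hk
    · have h := Bint_mono hST 0 huv hv.2
      push_cast
      linarith
    · rw [hB k hk u hu, hB k hk v hv]
  rw [hΓ t ⟨hs.1.trans hst, htT⟩]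
  exact skorokhod_eq_zero_of_antitoneOn hψ hs.1 hst htT hanti (hΓ s hs ▸ hzero 0)

/-- Absorption at zero: if `(ζ, ψ) ∈ C_T` admits some control `φ ∈ S_T(ζ, ψ)` and
`r(ζ(t*)) = 0` for some `t* ∈ [0,T]`, then `ζ ≡ 0` on `[t*, T]`; consequently `ζ ≡ 0`
on `[τ_ζ, T]` where `τ_ζ = min(inf{t ∈ [0,T] : r(ζ(t)) = 0}, T)` (whenever
`r(ζ(τ_ζ)) = 0`). -/
theorem absorption_at_zero (T : ℝ) (hT : 0 < T)
    (p : ℕ → ℝ) (hp0 : p 0 = 0) (hpnn : ∀ k, 0 ≤ p k) (hp1 : ∑' k : ℕ, p k = 1)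
    (hμsum : Summable fun k : ℕ => (k : ℝ) * p k)
    (ζ : ℕ → ℝ → ℝ) (ψ : ℝ → ℝ)
    (hCT : memCT T p ζ ψ)
    (φ : ℕ → ℝ → ℝ → ℝ) (hST : memST T p ζ ψ φ) :
    (∀ tstar ∈ Set.Icc (0 : ℝ) T, rtot (fun j => ζ j tstar) = 0 →
      ∀ t ∈ Set.Icc (0 : ℝ) T, tstar ≤ t → ∀ k, ζ k t = 0) ∧
    (rtot (fun j => ζ j
        (min (sInf {t ∈ Set.Icc (0 : ℝ) T | rtot (fun j => ζ j t) = 0}) T)) = 0 →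
      ∀ t ∈ Set.Icc (0 : ℝ) T,
        min (sInf {t ∈ Set.Icc (0 : ℝ) T | rtot (fun j => ζ j t) = 0}) T ≤ t →
        ∀ k, ζ k t = 0) := by
  have hpsum : Summable p := by
    by_contra h
    exact zero_ne_one ((tsum_eq_zero_of_not_summable h).symm.trans hp1)
  refine ⟨fun s hs h0 t ht hst k =>
    eq_zero_of_rtot_eq_zero_of_le hpsum hμsum hCT hST hs h0 hst ht.2 k, fun h0 t ht hst k =>
    eq_zero_of_rtot_eq_zero_of_le hpsum hμsum hCT hST ?_ h0 hst ht.2 k⟩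
  exact ⟨le_min (Real.sInf_nonneg fun u hu => hu.1.1) hT.le, min_le_right _ _⟩
end
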